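/- arXiv:math/0309037 — 6 statements merged into one kernel-verified Lean document; each statement's English description precedes it below -/
import Mathlib

section
/- Let π = α_1 α_2 … α_n ∈ ℙ^n, and form the sequence of tableaux S_0 = ∅, S_k = I_{α_k}(S_{k−1}) by successive insertion. If, during the insertion of α_k into S_{k−1}, the letter α_k enters the first row in column j (that is, α_k either replaces the entry in cell (1,j) or is appended to the first row in cell (1,j)), then the longest increasing subsequence of α_1 … α_k whose last term is the occurrence α_k has length exactly j. -/
/-!
Letters of `ℙ = {1' < 1 < 2' < 2 < ⋯}` are encoded as positive naturals: the unmarked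
letter `k` as `2k` (even) and the marked letter `k'` as `2k - 1` (odd), so that the
order of `ℙ` is the usual order on codes.
-/

/-- The column index (0-based) in which a letter `a` enters a (weakly increasing) row `R`
during insertion: for unmarked `a` (even code) it is the position of the smallest entry
strictly greater than `a` (BUMP), for marked `a` (odd code) the position of the smallest
entry `≥ a` (EQBUMP); if there is no such entry (`findIdx` returns `R.length`), `a` is
appended at the end of the row. -/
def bumpIdx (R : List ℕ) (a : ℕ) : ℕ :=
  R.findIdx fun b => if a % 2 = 0 then decide (a < b) else decide (a ≤ b)

/-- Insertion `I_a` of a letter `a` into a marked tableau, represented as its list of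
rows: `a` enters the first row at position `bumpIdx R a`, either replacing the entry
there (which is then inserted into the next row down) or, if `a` is `≥` (unmarked case),
resp. `>` (marked case), every entry of the row, appended at the end of the row. -/
def insertRows : List (List ℕ) → ℕ → List (List ℕ)
  | [], a => [[a]]
  | R :: rest, a =>
    if h : bumpIdx R a < R.length then
      R.set (bumpIdx R a) a :: insertRows rest (R.get ⟨bumpIdx R a, h⟩)
    else (R ++ [a]) :: rest

/-- A word over `ℙ` (in code form) is increasing when it is weakly increasing and contains
each marked letter (odd code) at most once. -/
def IncrWord (l : List ℕ) : Prop :=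
  l.Chain' (· ≤ ·) ∧ ∀ a : ℕ, a % 2 = 1 → l.count a ≤ 1

/-- `Follows x y` holds when `y` may stand after `x` in an increasing word. -/
def Follows (x y : ℕ) : Prop := x < y ∨ x = y ∧ y % 2 = 0

theorem incrWord_iff_pairwise_follows (l : List ℕ) : IncrWord l ↔ l.Pairwise Follows := by
  unfold IncrWord
  rw [List.Chain', List.isChain_iff_pairwise]
  induction l with
  | nil => simp
  | cons b l ih =>
    rw [List.pairwise_cons, List.pairwise_cons, ← ih]
    constructor
    · rintro ⟨⟨hb, hl⟩, hc⟩
      refine ⟨fun y hy => ?_, hl, fun a ha => ?_⟩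
      · rcases (hb y hy).lt_or_eq with h | rfl
        · exact Or.inl h
        · refine Or.inr ⟨rfl, ?_⟩
          by_contra hodd
          have h1 := hc b (by omega)
          rw [List.count_cons_self] at h1
          have := List.count_pos_iff.mpr hy
          omega
      · exact (List.count_le_count_cons).trans (hc a ha)
    · rintro ⟨hb, hl, hc⟩
      refine ⟨⟨fun y hy => ?_, hl⟩, fun a ha => ?_⟩
      · rcases hb y hy with h | h <;> omega
      · by_cases hab : b = a
        · subst hab
          have : b ∉ l := fun hy => by rcases hb b hy with h | h <;> omega
          simp [List.count_eq_zero_of_not_mem this]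
        · rw [List.count_cons_of_ne hab]
          exact hc a ha

theorem bumpIdx_le_length (R : List ℕ) (a : ℕ) : bumpIdx R a ≤ R.length :=
  List.findIdx_le_length

theorem follows_of_lt_bumpIdx {R : List ℕ} {a i x : ℕ} (hi : i < bumpIdx R a)
    (hx : R[i]? = some x) : Follows x a := by
  obtain ⟨h, rfl⟩ := List.getElem?_eq_some_iff.mp hx
  have := List.not_of_lt_findIdx hi
  unfold Follows
  split_ifs at this <;> simp at this <;> omega

theorem not_follows_of_getElem?_bumpIdx {R : List ℕ} {a x : ℕ}
    (hx : R[bumpIdx R a]? = some x) : ¬ Follows x a := by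
  obtain ⟨h, rfl⟩ := List.getElem?_eq_some_iff.mp hx
  have := List.findIdx_getElem (w := h)
  change ¬ (R[bumpIdx R a] < a ∨ R[bumpIdx R a] = a ∧ a % 2 = 0)
  change (if a % 2 = 0 then decide (a < R[bumpIdx R a])
    else decide (a ≤ R[bumpIdx R a])) = true at this
  split_ifs at this <;> simp at this <;> omega

theorem getElem?_headD_insertRows (S : List (List ℕ)) (a i : ℕ) :
    ((insertRows S a).headD [])[i]? =
      if i = bumpIdx (S.headD []) a then some a else (S.headD [])[i]? := by
  cases S with
  | nil => cases i <;> simp [insertRows, bumpIdx]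
  | cons R rest =>
    have hle := bumpIdx_le_length R a
    by_cases h : bumpIdx R a < R.length
    · simp only [insertRows, h, dite_true, List.headD_cons, List.getElem?_set]
      grind
    · have : bumpIdx R a = R.length := by omega
      simp only [insertRows, List.headD_cons, this]
      grind

/-- The first row `R` records the longest increasing subsequences of `u`: its `i`-th entry is
the smallest possible last term of an increasing subsequence with `i + 1` terms. -/
structure RecordsLastTerms (u R : List ℕ) : Prop where
  follows : ∀ {i j x y : ℕ}, i < j → R[i]? = some x → R[j]? = some y → Follows x y
  exists_sublist : ∀ {i x : ℕ}, R[i]? = some x →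
    ∃ l : List ℕ, l.length = i ∧ (l ++ [x]).Sublist u ∧ (l ++ [x]).Pairwise Follows
  exists_le : ∀ {l : List ℕ} {x : ℕ}, (l ++ [x]).Sublist u → (l ++ [x]).Pairwise Follows →
    ∃ y, R[l.length]? = some y ∧ y ≤ x

namespace RecordsLastTerms

variable {u R : List ℕ}

theorem le_of_le (h : RecordsLastTerms u R) {i j x y : ℕ} (hij : i ≤ j)
    (hx : R[i]? = some x) (hy : R[j]? = some y) : x ≤ y := by
  rcases hij.lt_or_eq with hlt | rfl
  · rcases h.follows hlt hx hy with h | h <;> omega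
  · simp_all

theorem exists_length_eq_bumpIdx (h : RecordsLastTerms u R) (a : ℕ) :
    ∃ l : List ℕ, l.length = bumpIdx R a ∧ l.Sublist u ∧ (l ++ [a]).Pairwise Follows := by
  have hle := bumpIdx_le_length R a
  rcases hj : bumpIdx R a with _ | j
  · exact ⟨[], rfl, List.nil_sublist _, by simp⟩
  · have hR : R[j]? = some R[j] := List.getElem?_eq_getElem (by omega)
    have hxa : Follows R[j] a := follows_of_lt_bumpIdx (by omega) hR
    obtain ⟨l, hl, hsub, hpw⟩ := h.exists_sublist hR
    refine ⟨l ++ [R[j]], by simp [hl], hsub, ?_⟩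
    rw [List.pairwise_append]
    refine ⟨hpw, List.pairwise_singleton _ _, fun x hx y hy => ?_⟩
    rw [List.pairwise_append] at hpw
    simp only [List.mem_append, List.mem_singleton] at hx hy
    subst hy
    rcases hx with hx | rfl
    · have := hpw.2.2 x hx R[j] (by simp)
      unfold Follows at *
      omega
    · exact hxa

theorem length_le_bumpIdx (h : RecordsLastTerms u R) {a : ℕ} {l : List ℕ} (hl : l.Sublist u)
    (hpw : (l ++ [a]).Pairwise Follows) : l.length ≤ bumpIdx R a := by
  rcases List.eq_nil_or_concat' l with rfl | ⟨l, x, rfl⟩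
  · simp
  · rw [List.pairwise_append] at hpw
    obtain ⟨y, hy, hyx⟩ := h.exists_le hl hpw.1
    have hxa : Follows x a := hpw.2.2 x (by simp) a (by simp)
    by_contra hlt
    simp only [List.length_append, List.length_singleton, not_le] at hlt
    have hlen := (List.getElem?_eq_some_iff.mp hy).1
    have hR : R[bumpIdx R a]? = some R[bumpIdx R a] := List.getElem?_eq_getElem (by omega)
    have hle := h.le_of_le (by omega) hR hy
    have hnot := not_follows_of_getElem?_bumpIdx hR
    unfold Follows at *
    omega

theorem insert (h : RecordsLastTerms u R) {a : ℕ} {R' : List ℕ}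
    (hR' : ∀ i, R'[i]? = if i = bumpIdx R a then some a else R[i]?) :
    RecordsLastTerms (u ++ [a]) R' := by
  have hfollows : ∀ {i j x y : ℕ}, i < j → R'[i]? = some x → R'[j]? = some y →
      Follows x y := by
    intro i j x y hij hx hy
    rw [hR'] at hx hy
    split_ifs at hx hy with hi hj hj
    · omega
    · obtain rfl := Option.some.inj hx
      subst hi
      have hlen := (List.getElem?_eq_some_iff.mp hy).1
      have hR : R[bumpIdx R a]? = some R[bumpIdx R a] := List.getElem?_eq_getElem (by omega)
      have h1 := h.follows hij hR hy
      have h2 := not_follows_of_getElem?_bumpIdx hR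
      unfold Follows at *
      omega
    · obtain rfl := Option.some.inj hy
      exact follows_of_lt_bumpIdx (hj ▸ hij) hx
    · exact h.follows hij hx hy
  refine ⟨hfollows, fun {i x} hx => ?_, fun {l x} hsub hpw => ?_⟩
  · rw [hR'] at hx
    split_ifs at hx with hi
    · obtain rfl := Option.some.inj hx
      obtain ⟨l, hl, hsub, hpw⟩ := h.exists_length_eq_bumpIdx a
      exact ⟨l, hl.trans hi.symm, hsub.append (List.Sublist.refl _), hpw⟩
    · obtain ⟨l, hl, hsub, hpw⟩ := h.exists_sublist hx
      exact ⟨l, hl, hsub.trans (List.sublist_append_left _ _), hpw⟩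
  · have hcases : (l ++ [x]).Sublist u ∨ x = a ∧ l.Sublist u := by
      have hrev := List.reverse_sublist.mpr hsub
      simp only [List.reverse_append, List.reverse_singleton, List.singleton_append] at hrev
      rcases List.sublist_cons_iff.mp hrev with h1 | ⟨r, hr, h1⟩
      · left
        rw [← List.reverse_sublist]
        simpa using h1
      · right
        obtain ⟨rfl, rfl⟩ := List.cons.inj hr
        exact ⟨rfl, List.reverse_sublist.mp h1⟩
    rcases hcases with hu | ⟨rfl, hu⟩
    · obtain ⟨y, hy, hyx⟩ := h.exists_le hu hpw
      by_cases hi : l.length = bumpIdx R a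
      · refine ⟨a, by rw [hR', if_pos hi], ?_⟩
        have := not_follows_of_getElem?_bumpIdx (hi ▸ hy)
        unfold Follows at this
        omega
      · exact ⟨y, by rw [hR', if_neg hi, hy], hyx⟩
    · have hle := h.length_le_bumpIdx hu hpw
      rcases hle.lt_or_eq with hlt | heq
      · have hlen := bumpIdx_le_length R x
        have hR : R[l.length]? = some R[l.length] := List.getElem?_eq_getElem (by omega)
        refine ⟨R[l.length], by rw [hR', if_neg hlt.ne, hR], ?_⟩
        rcases follows_of_lt_bumpIdx hlt hR with h | h <;> omega
      · exact ⟨x, by rw [hR', if_pos heq], le_rfl⟩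

end RecordsLastTerms

theorem recordsLastTerms_foldl_insertRows (u : List ℕ) :
    RecordsLastTerms u ((u.foldl insertRows []).headD []) := by
  induction u using List.reverseRecOn with
  | nil => constructor <;> simp
  | append_singleton u a ih =>
    rw [List.foldl_append]
    exact ih.insert (getElem?_headD_insertRows _ a)

/-- if `π = α_1 α_2 ⋯ ∈ ℙ^*` and `S_k = I_{α_k}(S_{k-1})` (starting from
`S_0 = ∅`), and if `α_{k+1}` enters the first row of `S_k` in column `j` (1-based, i.e.
`j = bumpIdx R (α_{k+1}) + 1` for `R` the first row of `S_k`), then the longest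
increasing subsequence of `α_1 ⋯ α_{k+1}` ending in the occurrence `α_{k+1}` has length
exactly `j`. -/
theorem insertion_column_eq_lis_length (w : List ℕ) (hw : ∀ a ∈ w, 1 ≤ a)
    (k : ℕ) (hk : k < w.length) :
    sSup {r : ℕ | ∃ l : List ℕ, l.Sublist (w.take k) ∧
        IncrWord (l ++ [w.get ⟨k, hk⟩]) ∧ r = l.length + 1} =
      bumpIdx (((w.take k).foldl insertRows []).headD []) (w.get ⟨k, hk⟩) + 1 := by
  have h := recordsLastTerms_foldl_insertRows (w.take k)
  refine IsGreatest.csSup_eq ⟨?_, ?_⟩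
  · obtain ⟨l, hl, hsub, hpw⟩ := h.exists_length_eq_bumpIdx (w.get ⟨k, hk⟩)
    exact ⟨l, hsub, (incrWord_iff_pairwise_follows _).mpr hpw, by rw [hl]⟩
  · rintro _ ⟨l, hsub, hinc, rfl⟩
    exact Nat.succ_le_succ
      (h.length_le_bumpIdx hsub ((incrWord_iff_pairwise_follows _).mp hinc))
end

section
/- Let m, n be positive integers, t ∈ ℝ, and x_1,…,x_m, y_1,…,y_n nonnegative reals such that x_i y_j < 1 and |t|·x_i y_j < 1 for all i, j. Then the series Σ_{k=1}^∞ (1/k)·(1 − t^k)·(Σ_{i=1}^m x_i^k)·(Σ_{j=1}^n y_j^k) converges, and its sum equals log ∏_{i=1}^m ∏_{j=1}^n (1 − t x_i y_j)/(1 − x_i y_j). (Equivalently, E(φ) = Z_t for the symbol φ = Ẽ_{x,t} E_y in the Borodin–Okounkov formula.) -/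
/-- Difference of two Mercator series: `Σ_{k≥1} (a^k - b^k)/k = log ((1 - b)/(1 - a))`. -/
theorem hasSum_pow_sub_pow_div_log {a b : ℝ} (ha : |a| < 1) (hb : |b| < 1) :
    HasSum (fun k : ℕ => (a ^ (k + 1) - b ^ (k + 1)) / ((k : ℝ) + 1))
      (Real.log ((1 - b) / (1 - a))) := by
  have ha' := (abs_lt.mp ha).2
  have hb' := (abs_lt.mp hb).2
  rw [Real.log_div (by linarith) (by linarith)]
  convert! (Real.hasSum_pow_div_log_of_abs_lt_one ha).sub
    (Real.hasSum_pow_div_log_of_abs_lt_one hb) using 1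
  · ext k
    rw [sub_div]
  · ring

/-- the series `Σ_{k≥1} (1/k)(1 - t^k)(Σ_i x_i^k)(Σ_j y_j^k)` converges and
its sum equals `log ∏_{i,j} (1 - t x_i y_j)/(1 - x_i y_j)`. -/
theorem tSchur_log_normalization (m n : ℕ) (hm : 0 < m) (hn : 0 < n) (t : ℝ)
    (x : Fin m → ℝ) (y : Fin n → ℝ) (hx : ∀ i, 0 ≤ x i) (hy : ∀ j, 0 ≤ y j)
    (hxy : ∀ i j, x i * y j < 1) (htxy : ∀ i j, |t| * (x i * y j) < 1) :
    (Summable fun k : ℕ =>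
      (1 / ((k : ℝ) + 1)) * (1 - t ^ (k + 1)) * (∑ i, x i ^ (k + 1)) * (∑ j, y j ^ (k + 1))) ∧
    ∑' k : ℕ,
      (1 / ((k : ℝ) + 1)) * (1 - t ^ (k + 1)) * (∑ i, x i ^ (k + 1)) * (∑ j, y j ^ (k + 1)) =
      Real.log (∏ i, ∏ j, (1 - t * (x i * y j)) / (1 - x i * y j)) := by
  have hlt : ∀ i j, |x i * y j| < 1 := fun i j => by
    rw [abs_of_nonneg (mul_nonneg (hx i) (hy j))]
    exact hxy i j
  have htlt : ∀ i j, |t * (x i * y j)| < 1 := fun i j => by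
    rw [abs_mul, abs_of_nonneg (mul_nonneg (hx i) (hy j))]
    exact htxy i j
  have hne : ∀ i j, (1 - t * (x i * y j)) / (1 - x i * y j) ≠ 0 := fun i j =>
    div_ne_zero (sub_pos.mpr (abs_lt.mp (htlt i j)).2).ne' (sub_pos.mpr (hxy i j)).ne'
  have key : HasSum (fun k : ℕ =>
      (1 / ((k : ℝ) + 1)) * (1 - t ^ (k + 1)) * (∑ i, x i ^ (k + 1)) * (∑ j, y j ^ (k + 1)))
      (Real.log (∏ i, ∏ j, (1 - t * (x i * y j)) / (1 - x i * y j))) := by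
    rw [Real.log_prod fun i _ => Finset.prod_ne_zero_iff.mpr fun j _ => hne i j]
    simp_rw [Real.log_prod fun j _ => hne _ j]
    convert! hasSum_sum fun i (_ : i ∈ Finset.univ) =>
      hasSum_sum fun j (_ : j ∈ Finset.univ) =>
        hasSum_pow_sub_pow_div_log (hlt i j) (htlt i j) using 1
    ext k
    rw [mul_assoc, Finset.sum_mul_sum, Finset.mul_sum]
    refine Finset.sum_congr rfl fun i _ => ?_
    rw [Finset.mul_sum]
    refine Finset.sum_congr rfl fun j _ => ?_
    simp only [mul_pow]
    ring
  exact ⟨key.summable, key.tsum_eq⟩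
end

section
/- Let 0 < α < 1, τ > 0 and t ≤ 0 be real numbers, and define F : (α, 1/α) → ℝ by F(z) = τ(1−t)(z² − tα²)/((z−α)²(z−tα)²) − 1/(1−αz)². Then F is strictly decreasing on (α, 1/α), F(z) → +∞ as z → α⁺, and F(z) → −∞ as z → (1/α)⁻; consequently there exists a unique z_0 ∈ (α, 1/α) with F(z_0) = 0. -/
/-- The saddle-point function `F(z) = τ(1-t)(z² - tα²)/((z-α)²(z-tα)²) - 1/(1-αz)²`. -/
noncomputable def saddleF (α τ t : ℝ) : ℝ → ℝ := fun z =>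
  τ * (1 - t) * (z ^ 2 - t * α ^ 2) / ((z - α) ^ 2 * (z - t * α) ^ 2) - 1 / (1 - α * z) ^ 2

theorem saddleF_eq_partialFractions {α t z : ℝ} (τ : ℝ) (h₁ : z - α ≠ 0) (h₂ : z - t * α ≠ 0) :
    saddleF α τ t z =
      τ * (((z - α) ^ 2)⁻¹ + -t * ((z - t * α) ^ 2)⁻¹) - ((1 - α * z) ^ 2)⁻¹ := by
  unfold saddleF
  rw [one_div]
  congr 1
  field_simp
  ring

theorem strictAntiOn_saddleF {α τ t : ℝ} (hα0 : 0 < α) (hτ : 0 < τ) (ht : t ≤ 0) :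
    StrictAntiOn (saddleF α τ t) (Set.Ioo α (1 / α)) := by
  intro x hx y hy hxy
  have htα : t * α ≤ 0 := mul_nonpos_of_nonpos_of_nonneg ht hα0.le
  have hxα : 0 < x - α := sub_pos.2 hx.1
  have hxt : 0 < x - t * α := by linarith
  have hyy : 0 < 1 - α * y := by
    have := (lt_div_iff₀ hα0).1 hy.2
    linarith
  have hαxy : α * x < α * y := by gcongr
  rw [saddleF_eq_partialFractions τ hxα.ne' hxt.ne',
    saddleF_eq_partialFractions τ (by linarith) (by linarith)]
  have h₁ : ((y - α) ^ 2)⁻¹ < ((x - α) ^ 2)⁻¹ := by gcongr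
  have h₂ : ((y - t * α) ^ 2)⁻¹ ≤ ((x - t * α) ^ 2)⁻¹ := by gcongr
  have h₃ : ((1 - α * x) ^ 2)⁻¹ ≤ ((1 - α * y) ^ 2)⁻¹ := by gcongr
  have h₄ := mul_le_mul_of_nonneg_left h₂ (neg_nonneg.2 ht)
  have h₅ := mul_lt_mul_of_pos_left (add_lt_add_of_lt_of_le h₁ h₄) hτ
  linarith

theorem continuousOn_saddleF {α τ t : ℝ} (hα0 : 0 < α) (ht : t ≤ 0) :
    ContinuousOn (saddleF α τ t) (Set.Ioo α (1 / α)) := by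
  intro z hz
  have htα : t * α ≤ 0 := mul_nonpos_of_nonpos_of_nonneg ht hα0.le
  have h₁ : z - α ≠ 0 := (sub_pos.2 hz.1).ne'
  have h₂ : z - t * α ≠ 0 := by linarith [hz.1]
  have h₃ : 1 - α * z ≠ 0 := by
    have := (lt_div_iff₀ hα0).1 hz.2
    linarith
  unfold saddleF
  apply ContinuousAt.continuousWithinAt
  fun_prop (disch := positivity)

theorem tendsto_inv_sq_nhdsNE {f : ℝ → ℝ} {a : ℝ} (hf : ContinuousAt f a) (hfa : f a = 0)
    (hne : ∀ z ≠ a, f z ≠ 0) :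
    Filter.Tendsto (fun z => (f z ^ 2)⁻¹) (nhdsWithin a {a}ᶜ) Filter.atTop := by
  apply Filter.Tendsto.inv_tendsto_nhdsGT_zero
  refine tendsto_nhdsWithin_iff.2 ⟨?_, ?_⟩
  · have h : Filter.Tendsto (fun z => f z ^ 2) (nhds a) (nhds (f a ^ 2)) := hf.tendsto.pow 2
    simpa [hfa] using h.mono_left nhdsWithin_le_nhds
  · filter_upwards [self_mem_nhdsWithin] with z hz
    exact sq_pos_of_ne_zero (hne z hz)

theorem tendsto_saddleF_nhdsGT {α τ t : ℝ} (hα0 : 0 < α) (hα1 : α < 1) (hτ : 0 < τ) (ht : t ≤ 0) :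
    Filter.Tendsto (saddleF α τ t) (nhdsWithin α (Set.Ioi α)) Filter.atTop := by
  have htα : t * α ≤ 0 := mul_nonpos_of_nonpos_of_nonneg ht hα0.le
  have hsing : Filter.Tendsto (fun z : ℝ => τ * ((z - α) ^ 2)⁻¹)
      (nhdsWithin α (Set.Ioi α)) Filter.atTop :=
    ((tendsto_inv_sq_nhdsNE (f := fun z => z - α) (by fun_prop) (sub_self α)
      fun z hz => sub_ne_zero.2 hz).mono_left (nhdsGT_le_nhdsNE α)).const_mul_atTop hτ
  have hreg : ContinuousAt
      (fun z : ℝ => τ * (-t * ((z - t * α) ^ 2)⁻¹) - ((1 - α * z) ^ 2)⁻¹) α := by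
    have h₂ : α - t * α ≠ 0 := by linarith
    have h₃ : 1 - α * α ≠ 0 := by nlinarith
    fun_prop (disch := positivity)
  refine (hsing.atTop_add (hreg.tendsto.mono_left nhdsWithin_le_nhds)).congr' ?_
  filter_upwards [self_mem_nhdsWithin] with z hz
  have hz : α < z := hz
  rw [saddleF_eq_partialFractions τ (by linarith) (by linarith)]
  ring

theorem tendsto_saddleF_nhdsLT {α : ℝ} (τ : ℝ) {t : ℝ} (hα0 : 0 < α) (hα1 : α < 1) (ht : t ≤ 0) :
    Filter.Tendsto (saddleF α τ t) (nhdsWithin (1 / α) (Set.Iio (1 / α))) Filter.atBot := by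
  have htα : t * α ≤ 0 := mul_nonpos_of_nonpos_of_nonneg ht hα0.le
  have hα : α < 1 / α := hα1.trans (one_lt_one_div hα0 hα1)
  have hsing : Filter.Tendsto (fun z : ℝ => -((1 - α * z) ^ 2)⁻¹)
      (nhdsWithin (1 / α) (Set.Iio (1 / α))) Filter.atBot := by
    refine Filter.tendsto_neg_atTop_atBot.comp ((tendsto_inv_sq_nhdsNE
      (f := fun z => 1 - α * z) (by fun_prop) ?_ ?_).mono_left (nhdsLT_le_nhdsNE _))
    · field_simp
      ring
    · intro z hz h
      exact hz ((eq_div_iff hα0.ne').2 (by linarith))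
  have hreg : ContinuousAt (fun z : ℝ =>
      τ * (1 - t) * (z ^ 2 - t * α ^ 2) / ((z - α) ^ 2 * (z - t * α) ^ 2)) (1 / α) := by
    have h₁ : 1 / α - α ≠ 0 := by linarith
    have h₂ : 1 / α - t * α ≠ 0 := by linarith
    fun_prop (disch := positivity)
  refine ((hreg.tendsto.mono_left nhdsWithin_le_nhds).add_atBot hsing).congr fun z => ?_
  simp only [saddleF, one_div, sub_eq_add_neg]

/-- `F` is strictly decreasing on `(α, 1/α)`, tends to `+∞` at `α⁺` and to
`-∞` at `(1/α)⁻`; consequently it has a unique zero `z₀` in `(α, 1/α)`. -/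
theorem saddleF_strictAnti_tendsto_existsUnique_zero (α τ t : ℝ)
    (hα0 : 0 < α) (hα1 : α < 1) (hτ : 0 < τ) (ht : t ≤ 0) :
    StrictAntiOn (saddleF α τ t) (Set.Ioo α (1 / α)) ∧
    Filter.Tendsto (saddleF α τ t) (nhdsWithin α (Set.Ioi α)) Filter.atTop ∧
    Filter.Tendsto (saddleF α τ t) (nhdsWithin (1 / α) (Set.Iio (1 / α))) Filter.atBot ∧
    ∃! z₀ : ℝ, z₀ ∈ Set.Ioo α (1 / α) ∧ saddleF α τ t z₀ = 0 := by
  have hanti := strictAntiOn_saddleF hα0 hτ ht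
  have htop := tendsto_saddleF_nhdsGT hα0 hα1 hτ ht
  have hbot := tendsto_saddleF_nhdsLT τ hα0 hα1 ht
  refine ⟨hanti, htop, hbot, ?_⟩
  have hα : α < 1 / α := hα1.trans (one_lt_one_div hα0 hα1)
  rw [← nhdsWithin_Ioo_eq_nhdsGT hα] at htop
  rw [← nhdsWithin_Ioo_eq_nhdsLT hα] at hbot
  have : (nhdsWithin α (Set.Ioo α (1 / α))).NeBot := left_nhdsWithin_Ioo_neBot hα
  have : (nhdsWithin (1 / α) (Set.Ioo α (1 / α))).NeBot := right_nhdsWithin_Ioo_neBot hα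
  obtain ⟨z₀, hz₀, h₀⟩ := isPreconnected_Ioo.intermediate_value_Iii
    (Filter.le_principal_iff.2 self_mem_nhdsWithin)
    (Filter.le_principal_iff.2 self_mem_nhdsWithin)
    (continuousOn_saddleF hα0 ht) hbot htop (Set.mem_univ 0)
  exact ⟨z₀, ⟨hz₀, h₀⟩, fun z hz => hanti.injOn hz.1 hz₀ (hz.2.trans h₀.symm)⟩
end

section
/- Let 0 < α < 1, τ > 0, t ≤ 0, and let z_0 ∈ (α, 1/α) be the unique zero of F(z) = τ(1−t)(z²−tα²)/((z−α)²(z−tα)²) − 1/(1−αz)² on (α, 1/α). Set c := α z_0 ( τ(1−t)/((z_0−α)(z_0−tα)) + 1/(1−α z_0) ) and define g(z) := τα(1−t)/((z−α)(z−tα)) + α/(1−αz) − c/z for z ∈ (α, 1/α). Then: (i) c > 0; (ii) g(z_0) = 0 and g'(z_0) = 0; (iii) g(z) > 0 for every z ∈ (α, 1/α) with z ≠ z_0; and (iv) g''(z_0) > 0. (Here g = σ', so (ii) says σ'(z_0) = σ''(z_0) = 0 and (iv) says σ'''(z_0) > 0.) -/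
/-- The centering constant `c = α z₀ (τ(1-t)/((z₀-α)(z₀-tα)) + 1/(1-αz₀))`. -/
noncomputable def centerC (α τ t z₀ : ℝ) : ℝ :=
  α * z₀ * (τ * (1 - t) / ((z₀ - α) * (z₀ - t * α)) + 1 / (1 - α * z₀))

/-- The function `g = σ'`, `g(z) = τα(1-t)/((z-α)(z-tα)) + α/(1-αz) - c/z`. -/
noncomputable def sigmaDeriv (α τ t c : ℝ) : ℝ → ℝ := fun z =>
  τ * α * (1 - t) / ((z - α) * (z - t * α)) + α / (1 - α * z) - c / z

open Filter Topology in
/-- The second-order jet at `w` of a function agreeing near `w` with `(z - w)² Q z`. -/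
theorem deriv_and_deriv_deriv_of_eventuallyEq_sq_mul {g Q : ℝ → ℝ} {w : ℝ}
    (hQ : ContDiffAt ℝ 2 Q w) (hg : g =ᶠ[𝓝 w] fun z => (z - w) ^ 2 * Q z) :
    deriv g w = 0 ∧ deriv (deriv g) w = 2 * Q w := by
  have hQd : ∀ᶠ z in 𝓝 w, DifferentiableAt ℝ Q z :=
    (hQ.eventually (by simp)).mono fun z hz => hz.differentiableAt (by simp)
  have hQ' : DifferentiableAt ℝ (deriv Q) w :=
    (hQ.derivWithin (m := 1) (by norm_num)).differentiableAt (by simp)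
  have hsq : ∀ z, HasDerivAt (fun z : ℝ => (z - w) ^ 2) (2 * (z - w)) z := fun z => by
    simpa using ((hasDerivAt_id z).sub_const w).fun_pow 2
  have hg' : deriv g =ᶠ[𝓝 w] fun z => 2 * (z - w) * Q z + (z - w) ^ 2 * deriv Q z := by
    filter_upwards [hQd, hg.deriv] with z hz hgz
    rw [hgz]
    exact ((hsq z).fun_mul hz.hasDerivAt).deriv
  refine ⟨by simpa using hg'.self_of_nhds, ?_⟩
  rw [hg'.deriv_eq]
  have hlin : HasDerivAt (fun z : ℝ => 2 * (z - w)) 2 w := by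
    simpa using ((hasDerivAt_id w).sub_const w).const_mul 2
  have := ((hlin.fun_mul hQd.self_of_nhds.hasDerivAt).fun_add
    ((hsq w).fun_mul hQ'.hasDerivAt)).deriv
  simpa using this

/-- The quotient of `sigmaDeriv` by `(z - w)²` when `w` is a zero of `saddleF`. -/
noncomputable def saddleQuotient (α τ t w : ℝ) : ℝ → ℝ := fun z =>
  α * (τ * (1 / ((z - α) * (w - α) ^ 2) - t / ((z - t * α) * (w - t * α) ^ 2)) +
    α / ((1 - α * z) * (1 - α * w) ^ 2)) / z

theorem saddle_factors_pos {α t z : ℝ} (hα : 0 < α) (ht : t ≤ 0)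
    (hz : z ∈ Set.Ioo α (1 / α)) :
    0 < z ∧ 0 < z - α ∧ 0 < z - t * α ∧ 0 < 1 - α * z := by
  obtain ⟨h₁, h₂⟩ := hz
  rw [lt_div_iff₀ hα] at h₂
  have := mul_nonneg (neg_nonneg.2 ht) hα.le
  exact ⟨by linarith, by linarith, by linarith, by linarith⟩

theorem saddleQuotient_pos {α τ t w z : ℝ} (hα : 0 < α) (hτ : 0 < τ) (ht : t ≤ 0)
    (hw : w ∈ Set.Ioo α (1 / α)) (hz : z ∈ Set.Ioo α (1 / α)) :
    0 < saddleQuotient α τ t w z := by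
  obtain ⟨_, hw₁, hw₂, hw₃⟩ := saddle_factors_pos hα ht hw
  obtain ⟨hz₀, hz₁, hz₂, hz₃⟩ := saddle_factors_pos hα ht hz
  have h₁ : 0 < 1 / ((z - α) * (w - α) ^ 2) := by positivity
  have h₂ : t / ((z - t * α) * (w - t * α) ^ 2) ≤ 0 :=
    div_nonpos_of_nonpos_of_nonneg ht (by positivity)
  have h₃ := mul_pos hτ (sub_pos.2 (h₂.trans_lt h₁))
  unfold saddleQuotient
  positivity

theorem contDiffAt_saddleQuotient {α t w z : ℝ} (τ : ℝ) (hα : 0 < α) (ht : t ≤ 0)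
    (hw : w ∈ Set.Ioo α (1 / α)) (hz : z ∈ Set.Ioo α (1 / α)) :
    ContDiffAt ℝ 2 (saddleQuotient α τ t w) z := by
  obtain ⟨_, hw₁, hw₂, hw₃⟩ := saddle_factors_pos hα ht hw
  obtain ⟨hz₀, hz₁, hz₂, hz₃⟩ := saddle_factors_pos hα ht hz
  unfold saddleQuotient
  fun_prop (disch := positivity)

theorem sigmaDeriv_eq_sq_mul_saddleQuotient {α τ t w z : ℝ} (hα : 0 < α) (ht : t ≤ 0)
    (hw : w ∈ Set.Ioo α (1 / α)) (hFw : saddleF α τ t w = 0) (hz : z ∈ Set.Ioo α (1 / α)) :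
    sigmaDeriv α τ t (centerC α τ t w) z = (z - w) ^ 2 * saddleQuotient α τ t w z := by
  obtain ⟨_, hw₁, hw₂, hw₃⟩ := saddle_factors_pos hα ht hw
  obtain ⟨hz₀, hz₁, hz₂, hz₃⟩ := saddle_factors_pos hα ht hz
  have key : sigmaDeriv α τ t (centerC α τ t w) z =
      (z - w) ^ 2 * saddleQuotient α τ t w z - α * (z - w) * saddleF α τ t w / z := by
    have e₁ : τ * (1 - t) * z / ((z - α) * (z - t * α)) -
        τ * (1 - t) * w / ((w - α) * (w - t * α)) =
        (z - w) ^ 2 * τ * (1 / ((z - α) * (w - α) ^ 2) - t / ((z - t * α) * (w - t * α) ^ 2)) -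
        (z - w) * (τ * (1 - t) * (w ^ 2 - t * α ^ 2) / ((w - α) ^ 2 * (w - t * α) ^ 2)) := by
      field_simp
      ring
    have e₂ : z / (1 - α * z) - w / (1 - α * w) =
        (z - w) ^ 2 * (α / ((1 - α * z) * (1 - α * w) ^ 2)) +
        (z - w) * (1 / (1 - α * w) ^ 2) := by
      have hz₄ : 1 - z * α ≠ 0 := mul_comm α z ▸ hz₃.ne'
      field_simp
      ring
    have e₃ : sigmaDeriv α τ t (centerC α τ t w) z =
        α * ((τ * (1 - t) * z / ((z - α) * (z - t * α)) -
          τ * (1 - t) * w / ((w - α) * (w - t * α))) +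
          (z / (1 - α * z) - w / (1 - α * w))) / z := by
      unfold sigmaDeriv centerC
      rw [eq_div_iff hz₀.ne', sub_mul, div_mul_cancel₀ _ hz₀.ne']
      ring
    rw [e₃, e₁, e₂]
    unfold saddleQuotient saddleF
    ring
  rw [key, hFw]
  ring

/-- with `z₀` the zero of `F` on `(α, 1/α)` and `c` as above:
(i) `c > 0`; (ii) `g(z₀) = 0` and `g'(z₀) = 0`; (iii) `g > 0` on `(α,1/α) \ {z₀}`;
(iv) `g''(z₀) > 0`. -/
theorem saddle_point_properties (α τ t z₀ : ℝ)
    (hα0 : 0 < α) (hα1 : α < 1) (hτ : 0 < τ) (ht : t ≤ 0)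
    (hz₀ : z₀ ∈ Set.Ioo α (1 / α)) (hFz₀ : saddleF α τ t z₀ = 0) :
    0 < centerC α τ t z₀ ∧
    sigmaDeriv α τ t (centerC α τ t z₀) z₀ = 0 ∧
    deriv (sigmaDeriv α τ t (centerC α τ t z₀)) z₀ = 0 ∧
    (∀ z ∈ Set.Ioo α (1 / α), z ≠ z₀ → 0 < sigmaDeriv α τ t (centerC α τ t z₀) z) ∧
    0 < deriv (deriv (sigmaDeriv α τ t (centerC α τ t z₀))) z₀ := by
  obtain ⟨hw₀, hw₁, hw₂, hw₃⟩ := saddle_factors_pos hα0 ht hz₀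
  have ht' : 0 < 1 - t := by linarith
  have hfac {z : ℝ} (hz : z ∈ Set.Ioo α (1 / α)) :=
    sigmaDeriv_eq_sq_mul_saddleQuotient hα0 ht hz₀ hFz₀ hz
  obtain ⟨h₁, h₂⟩ := deriv_and_deriv_deriv_of_eventuallyEq_sq_mul
    (contDiffAt_saddleQuotient τ hα0 ht hz₀ hz₀)
    (Filter.eventually_of_mem (Ioo_mem_nhds hz₀.1 hz₀.2) fun z hz => hfac hz)
  refine ⟨?_, ?_, h₁, ?_, ?_⟩
  · unfold centerC
    positivity
  · simp [hfac hz₀]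
  · intro z hz hne
    rw [hfac hz]
    exact mul_pos (sq_pos_of_ne_zero (sub_ne_zero.2 hne)) (saddleQuotient_pos hα0 hτ ht hz₀ hz)
  · rw [h₂]
    exact mul_pos two_pos (saddleQuotient_pos hα0 hτ ht hz₀ hz₀)
end

section
/- Let 0 < α < 1, τ > 0 and t < 0 be real numbers, let z_0 ∈ (α, 1/α) be the unique zero on (α, 1/α) of F(z) = τ(1−t)(z²−tα²)/((z−α)²(z−tα)²) − 1/(1−αz)², and set c := α z_0 ( τ(1−t)/((z_0−α)(z_0−tα)) + 1/(1−α z_0) ). Then the function g(z) := τα(1−t)/((z−α)(z−tα)) + α/(1−αz) − c/z, which is well defined on the interval (tα, 0), has a zero in (tα, 0). -/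
/-- The centering constant is positive. -/
theorem centerC_pos {α τ t z₀ : ℝ} (hα0 : 0 < α) (hτ : 0 < τ) (ht : t < 0)
    (hz₀ : z₀ ∈ Set.Ioo α (1 / α)) : 0 < centerC α τ t z₀ := by
  obtain ⟨h1, h2⟩ := hz₀
  have hz : 0 < z₀ := hα0.trans h1
  have ha : 0 < z₀ - α := sub_pos.2 h1
  have hb : 0 < z₀ - t * α := by nlinarith
  have hd : 0 < 1 - α * z₀ := by
    rw [lt_div_iff₀ hα0] at h2
    linarith
  have ht' : 0 < 1 - t := by linarith
  unfold centerC
  positivity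

/-- For `t < 0` and any `c > 0`, the function `sigmaDeriv α τ t c` vanishes in `(tα, 0)`. -/
theorem exists_sigmaDeriv_eq_zero {α τ t c : ℝ} (hα0 : 0 < α) (hτ : 0 < τ) (ht : t < 0)
    (hc : 0 < c) : ∃ z ∈ Set.Ioo (t * α) 0, sigmaDeriv α τ t c z = 0 := by
  have htα : t * α < 0 := mul_neg_of_neg_of_pos ht hα0
  -- Clear denominators and apply the intermediate value theorem to the resulting polynomial.
  let p : ℝ → ℝ := fun z => τ * α * (1 - t) * (z * (1 - α * z))
    + α * z * ((z - α) * (z - t * α)) - c * ((z - α) * (z - t * α) * (1 - α * z))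
  have hp : ContinuousOn p (Set.Icc (t * α) 0) := by fun_prop
  have hleft : p (t * α) < 0 := by
    have hd : 0 < 1 - α * (t * α) := by nlinarith
    have ht' : 0 < 1 - t := by linarith
    have h : τ * α * (1 - t) * (t * α * (1 - α * (t * α))) < 0 :=
      mul_neg_of_pos_of_neg (by positivity) (mul_neg_of_neg_of_pos htα hd)
    simpa [p] using h
  have hright : 0 < p 0 := by
    have h : p 0 = c * α * -(t * α) := by simp only [p]; ring
    rw [h]
    exact mul_pos (by positivity) (neg_pos.2 htα)
  obtain ⟨z, ⟨hz1, hz2⟩, hz⟩ := intermediate_value_Ioo htα.le hp ⟨hleft, hright⟩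
  refine ⟨z, ⟨hz1, hz2⟩, ?_⟩
  have ha : z - α ≠ 0 := by linarith
  have hb : z - t * α ≠ 0 := (sub_pos.2 hz1).ne'
  have hd : 1 - α * z ≠ 0 := by nlinarith
  have hfactor : sigmaDeriv α τ t c z
      = p z / ((z - α) * (z - t * α) * (1 - α * z) * z) := by
    simp only [sigmaDeriv, p]
    have hz0 : z ≠ 0 := hz2.ne
    generalize t * α = s at hb ⊢
    field_simp
  rw [hfactor, hz, zero_div]

/-- for `t < 0` the function `g = σ'` has a zero in the interval `(tα, 0)`. -/
theorem sigmaDeriv_has_zero_in_neg_interval (α τ t z₀ : ℝ)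
    (hα0 : 0 < α) (hα1 : α < 1) (hτ : 0 < τ) (ht : t < 0)
    (hz₀ : z₀ ∈ Set.Ioo α (1 / α)) (hFz₀ : saddleF α τ t z₀ = 0) :
    ∃ z ∈ Set.Ioo (t * α) 0, sigmaDeriv α τ t (centerC α τ t z₀) z = 0 :=
  exists_sigmaDeriv_eq_zero hα0 hτ ht (centerC_pos hα0 hτ ht hz₀)
end

section
/- Let 0 < α < 1 and τ > 0 be real numbers, set z_0 := (α + √τ)/(1 + √τ·α), c := α z_0 ( τ/((z_0−α) z_0) + 1/(1−α z_0) ), and define g(z) := τα/((z−α)z) + α/(1−αz) − c/z on (α, 1/α). Then g''(z_0) > 0, and z_0 · ( g''(z_0)/2 )^{1/3} = α^{1/3} τ^{−1/6} (α + √τ)^{2/3} (1 + √τ·α)^{2/3} / (1 − α²). (In the paper's notation, g = σ', so this computes the scaling constant c_2(α, τ, 0) = g^{−1} with g = z_0^{−1}(2/σ'''(z_0))^{1/3}.) -/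
/-- The function `g = σ'` at `t = 0`: `g(z) = τα/((z-α)z) + α/(1-αz) - c/z`. -/
noncomputable def sigmaDeriv0 (α τ c : ℝ) : ℝ → ℝ := fun z =>
  τ * α / ((z - α) * z) + α / (1 - α * z) - c / z

theorem sigmaDeriv0_eq_partialFractions {α z : ℝ} (τ c : ℝ) (h1 : z - α ≠ 0) (h2 : z ≠ 0) :
    sigmaDeriv0 α τ c z = τ * (z - α)⁻¹ + α * (1 - α * z)⁻¹ - (τ + c) * z⁻¹ := by
  have h : τ * α / ((z - α) * z) = τ * (z - α)⁻¹ - τ * z⁻¹ := by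
    field_simp
    ring
  rw [sigmaDeriv0, h]
  ring

theorem hasDerivAt_sigmaDeriv0 {α z : ℝ} (τ c : ℝ) (h1 : z - α ≠ 0) (h2 : z ≠ 0)
    (h3 : 1 - α * z ≠ 0) :
    HasDerivAt (sigmaDeriv0 α τ c)
      (-τ * ((z - α) ^ 2)⁻¹ + α ^ 2 * ((1 - α * z) ^ 2)⁻¹ + (τ + c) * (z ^ 2)⁻¹) z := by
  have d1 := (((hasDerivAt_id z).sub_const α).fun_inv h1).const_mul τ
  have d3 := ((((hasDerivAt_id z).const_mul α).const_sub 1).fun_inv h3).const_mul α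
  have d2 := ((hasDerivAt_id z).fun_inv h2).const_mul (τ + c)
  have hev : sigmaDeriv0 α τ c =ᶠ[nhds z]
      fun w => τ * (w - α)⁻¹ + α * (1 - α * w)⁻¹ - (τ + c) * w⁻¹ := by
    filter_upwards [(continuous_id.sub continuous_const).continuousAt.eventually_ne h1,
      continuous_id.continuousAt.eventually_ne h2] with w hw1 hw2
    exact sigmaDeriv0_eq_partialFractions τ c hw1 hw2
  refine HasDerivAt.congr_of_eventuallyEq ?_ hev
  refine ((d1.add d3).sub d2).congr_deriv ?_
  simp only [id]
  ring

theorem deriv_deriv_sigmaDeriv0 {α z : ℝ} (τ c : ℝ) (h1 : z - α ≠ 0) (h2 : z ≠ 0)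
    (h3 : 1 - α * z ≠ 0) :
    deriv (deriv (sigmaDeriv0 α τ c)) z =
      2 * (τ / (z - α) ^ 3 + α ^ 3 / (1 - α * z) ^ 3 - (τ + c) / z ^ 3) := by
  have hev : deriv (sigmaDeriv0 α τ c) =ᶠ[nhds z] fun w =>
      -τ * ((w - α) ^ 2)⁻¹ + α ^ 2 * ((1 - α * w) ^ 2)⁻¹ + (τ + c) * (w ^ 2)⁻¹ := by
    filter_upwards [(continuous_id.sub continuous_const).continuousAt.eventually_ne h1,
      continuous_id.continuousAt.eventually_ne h2,
      (continuous_const.sub (continuous_const.mul continuous_id)).continuousAt.eventually_ne h3]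
      with w hw1 hw2 hw3
    exact (hasDerivAt_sigmaDeriv0 τ c hw1 hw2 hw3).deriv
  rw [hev.deriv_eq]
  have d1 := ((((hasDerivAt_id z).sub_const α).fun_pow 2).fun_inv (pow_ne_zero 2 h1)).const_mul (-τ)
  have d3 := (((((hasDerivAt_id z).const_mul α).const_sub 1).fun_pow 2).fun_inv
    (pow_ne_zero 2 h3)).const_mul (α ^ 2)
  have d2 := (((hasDerivAt_id z).fun_pow 2).fun_inv (pow_ne_zero 2 h2)).const_mul (τ + c)
  refine ((d1.add d3).add d2).deriv.trans ?_
  simp only [id]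
  generalize 1 - α * z = b at h3 ⊢
  generalize z - α = a at h1 ⊢
  field_simp
  ring

theorem deriv_deriv_sigmaDeriv0_critical {α s z c : ℝ} (hα0 : 0 < α) (hα1 : α < 1) (hs : 0 < s)
    (hz : z = (α + s) / (1 + s * α))
    (hc : c = α * z * (s ^ 2 / ((z - α) * z) + 1 / (1 - α * z))) :
    deriv (deriv (sigmaDeriv0 α (s ^ 2) c)) z =
      2 * (α * (1 + s * α) ^ 5 / ((1 - α ^ 2) ^ 3 * s * (α + s))) := by
  have hD : 0 < 1 + s * α := by positivity
  have hN : 0 < α + s := by positivity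
  have hE : 0 < 1 - α ^ 2 := by nlinarith
  have e1 : z - α = s * (1 - α ^ 2) / (1 + s * α) := by
    rw [hz]
    field_simp
    ring
  have e3 : 1 - α * z = (1 - α ^ 2) / (1 + s * α) := by
    rw [hz]
    field_simp
    ring
  have hz0 : 0 < z := by rw [hz]; positivity
  have hc' : s ^ 2 + c = (α + s) ^ 2 / (1 - α ^ 2) := by
    rw [hc, e1, e3, hz]
    field_simp
    ring
  rw [deriv_deriv_sigmaDeriv0 _ _ (by rw [e1]; positivity) hz0.ne' (by rw [e3]; positivity),
    hc', e1, e3, hz]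
  field_simp
  ring

/-- at `t = 0`, with `z₀ = (α+√τ)/(1+√τ α)` and
`c = α z₀ (τ/((z₀-α)z₀) + 1/(1-αz₀))`, one has `g''(z₀) > 0` and
`z₀ (g''(z₀)/2)^{1/3} = α^{1/3} τ^{-1/6} (α+√τ)^{2/3} (1+√τ α)^{2/3} / (1-α²)`. -/
theorem scaling_constant_t_zero (α τ : ℝ) (hα0 : 0 < α) (hα1 : α < 1) (hτ : 0 < τ)
    (z₀ c : ℝ) (hz₀ : z₀ = (α + Real.sqrt τ) / (1 + Real.sqrt τ * α))
    (hc : c = α * z₀ * (τ / ((z₀ - α) * z₀) + 1 / (1 - α * z₀))) :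
    0 < deriv (deriv (sigmaDeriv0 α τ c)) z₀ ∧
    z₀ * (deriv (deriv (sigmaDeriv0 α τ c)) z₀ / 2) ^ ((1 : ℝ) / 3) =
      α ^ ((1 : ℝ) / 3) * τ ^ (-(1 / 6) : ℝ) * (α + Real.sqrt τ) ^ ((2 : ℝ) / 3) *
        (1 + Real.sqrt τ * α) ^ ((2 : ℝ) / 3) / (1 - α ^ 2) := by
  obtain ⟨s, hs, rfl⟩ : ∃ s : ℝ, 0 < s ∧ s ^ 2 = τ :=
    ⟨Real.sqrt τ, Real.sqrt_pos.2 hτ, Real.sq_sqrt hτ.le⟩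
  rw [Real.sqrt_sq hs.le] at hz₀ ⊢
  have hD : 0 < 1 + s * α := by positivity
  have hN : 0 < α + s := by positivity
  have hE : 0 < 1 - α ^ 2 := by nlinarith
  have hz0 : 0 < z₀ := by rw [hz₀]; positivity
  rw [deriv_deriv_sigmaDeriv0_critical hα0 hα1 hs hz₀ hc]
  refine ⟨by positivity, ?_⟩
  rw [mul_div_cancel_left₀ _ (two_ne_zero' ℝ)]
  have cube_third {x : ℝ} (hx : 0 < x) : (x ^ ((1 : ℝ) / 3)) ^ 3 = x := by
    rw [← Real.rpow_natCast, ← Real.rpow_mul hx.le]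
    norm_num
  have cube_two_thirds {x : ℝ} (hx : 0 < x) : (x ^ ((2 : ℝ) / 3)) ^ 3 = x ^ 2 := by
    rw [← Real.rpow_natCast, ← Real.rpow_mul hx.le, ← Real.rpow_natCast]
    norm_num
  have cube_sixth : ((s ^ 2) ^ (-(1 / 6) : ℝ)) ^ 3 = s⁻¹ := by
    rw [← Real.rpow_natCast, ← Real.rpow_natCast, ← Real.rpow_mul hs.le, ← Real.rpow_mul hs.le,
      ← Real.rpow_neg_one]
    norm_num
  refine (pow_left_inj₀ (by positivity) (by positivity) three_ne_zero).1 ?_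
  rw [mul_pow, cube_third (by positivity), div_pow, mul_pow, mul_pow, mul_pow, cube_third hα0,
    cube_sixth, cube_two_thirds hN, cube_two_thirds hD, hz₀]
  field_simp
end
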